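/- arXiv:2511.01486 — 4 statements merged into one kernel-verified Lean document; each statement's English description precedes it below -/
import Mathlib

section
/- Let (M,d) be a metric space, let μ₁, …, μ_m ∈ M, let w₁, …, w_m be strictly positive real weights with w₁ + ⋯ + w_m = 1, and let ν ∈ M be a minimizer over M of the function x ↦ Σ_{i=1}^m w_i · d(x, μ_i)². Then for every ρ ∈ M one has d(ν, ρ)² ≤ 4 · max_{1 ≤ i ≤ m} d(μ_i, ρ)². -/
open scoped BigOperators

/-- barycenter domination. In a metric space `M`, if `ν` minimizes
`x ↦ Σᵢ wᵢ · d(x, μᵢ)²` for strictly positive weights `wᵢ` summing to `1`, then for every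
`ρ ∈ M` one has `d(ν, ρ)² ≤ 4 · maxᵢ d(μᵢ, ρ)²`. -/
theorem barycenter_domination
    {M : Type*} [MetricSpace M] {m : ℕ}
    (μ : Fin m → M) (w : Fin m → ℝ)
    (hw : ∀ i, 0 < w i) (hsum : ∑ i, w i = 1)
    (ν : M)
    (hν : ∀ x : M, ∑ i, w i * dist ν (μ i) ^ 2 ≤ ∑ i, w i * dist x (μ i) ^ 2)
    (ρ : M) :
    dist ν ρ ^ 2 ≤ 4 * ⨆ i, dist (μ i) ρ ^ 2 := by
  have triangle_sq (i : Fin m) :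
      dist ν ρ ^ 2 ≤ 2 * dist ν (μ i) ^ 2 + 2 * dist ρ (μ i) ^ 2 := by
    have h := dist_triangle_right ν ρ (μ i)
    nlinarith [sq_nonneg (dist ν (μ i) - dist ρ (μ i)), dist_nonneg (x := ν) (y := ρ)]
  have le_sup (i : Fin m) : dist ρ (μ i) ^ 2 ≤ ⨆ j, dist (μ j) ρ ^ 2 := by
    rw [dist_comm]
    exact le_ciSup (f := fun j ↦ dist (μ j) ρ ^ 2) (Set.finite_range _).bddAbove i
  calc dist ν ρ ^ 2
      = ∑ i, w i * dist ν ρ ^ 2 := by rw [← Finset.sum_mul, hsum, one_mul]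
    _ ≤ ∑ i, w i * (2 * dist ν (μ i) ^ 2 + 2 * dist ρ (μ i) ^ 2) :=
        Finset.sum_le_sum fun i _ ↦ mul_le_mul_of_nonneg_left (triangle_sq i) (hw i).le
    _ = 2 * ∑ i, w i * dist ν (μ i) ^ 2 + 2 * ∑ i, w i * dist ρ (μ i) ^ 2 := by
        rw [Finset.mul_sum, Finset.mul_sum, ← Finset.sum_add_distrib]
        exact Finset.sum_congr rfl fun i _ ↦ by ring
    _ ≤ 4 * ∑ i, w i * dist ρ (μ i) ^ 2 := by linarith [hν ρ]
    _ ≤ 4 * ∑ i, w i * ⨆ j, dist (μ j) ρ ^ 2 := by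
        gcongr with i
        · exact (hw i).le
        · exact le_sup i
    _ = 4 * ⨆ i, dist (μ i) ρ ^ 2 := by rw [← Finset.sum_mul, hsum, one_mul]
end

section
/- Let γ > 0, α > 0, a ∈ ℝ, and let θ* ∈ ℝ satisfy the fixed-point equation ψ(θ*) = a + (α/γ)·θ*. Define F(μ) := (γ/2)·(∫_Λ ρ dμ − a)² + α·KL(μ‖π) for probability measures μ on Λ. Then μ_{θ*} is the unique minimizer of F over the set of probability measures μ on Λ with μ ≪ π: F(μ_{θ*}) ≤ F(μ) for all such μ, with equality only if μ = μ_{θ*}. -/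
open MeasureTheory
open scoped ENNReal

/-- Partition function `Z(θ) = ∫ exp(−θρ) dπ` of the exponential tilt. -/
noncomputable def partitionZ {Λ : Type*} [MeasurableSpace Λ] (π : Measure Λ) (ρ : Λ → ℝ)
    (θ : ℝ) : ℝ :=
  ∫ x, Real.exp (-θ * ρ x) ∂π

/-- Exponentially tilted (Gibbs) measure `dμ_θ/dπ = exp(−θρ)/Z(θ)`. -/
noncomputable def gibbsTilt {Λ : Type*} [MeasurableSpace Λ] (π : Measure Λ) (ρ : Λ → ℝ)
    (θ : ℝ) : Measure Λ :=
  π.withDensity (fun x => ENNReal.ofReal (Real.exp (-θ * ρ x) / partitionZ π ρ θ))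

/-- Tilted mean `ψ(θ) = ∫ ρ dμ_θ`. -/
noncomputable def tiltMean {Λ : Type*} [MeasurableSpace Λ] (π : Measure Λ) (ρ : Λ → ℝ)
    (θ : ℝ) : ℝ :=
  ∫ x, ρ x ∂(gibbsTilt π ρ θ)

-- Kullback–Leibler divergence `KL(μ‖π) = ∫ log (dμ/dπ) dμ`, set to `∞` if `μ` is not
-- absolutely continuous with respect to `π` (or if the integral does not exist).
open Classical in
noncomputable def klDiv' {Λ : Type*} [MeasurableSpace Λ] (μ π : Measure Λ) : ℝ≥0∞ :=
  if μ ≪ π ∧ Integrable (fun x => Real.log (μ.rnDeriv π x).toReal) μ then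
    ENNReal.ofReal (∫ x, Real.log (μ.rnDeriv π x).toReal ∂μ)
  else ∞

/-- The penalized objective `F(μ) = (γ/2)(∫ρ dμ − a)² + α · KL(μ‖π)` (valued in `ℝ≥0∞`). -/
noncomputable def aggObjective {Λ : Type*} [MeasurableSpace Λ] (γ α a : ℝ) (π : Measure Λ)
    (ρ : Λ → ℝ) (μ : Measure Λ) : ℝ≥0∞ :=
  ENNReal.ofReal (γ / 2 * ((∫ x, ρ x ∂μ) - a) ^ 2) + ENNReal.ofReal α * klDiv' μ π

section GibbsTilt

open InformationTheory

variable {Λ : Type*} [MeasurableSpace Λ] {π μ : Measure Λ} {ρ : Λ → ℝ} {B : ℝ}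

lemma integrable_of_abs_le [IsFiniteMeasure μ] (hρ : Measurable ρ) (hB : ∀ x, |ρ x| ≤ B) :
    Integrable ρ μ :=
  .of_bound hρ.aestronglyMeasurable B (.of_forall hB)

lemma integrable_exp_mul_of_abs_le [IsFiniteMeasure μ] (hρ : Measurable ρ)
    (hB : ∀ x, |ρ x| ≤ B) (c : ℝ) : Integrable (fun x => Real.exp (c * ρ x)) μ := by
  refine .of_bound (by fun_prop) (Real.exp (|c| * B)) (.of_forall fun x => ?_)
  rw [Real.norm_eq_abs, Real.abs_exp, Real.exp_le_exp]
  calc c * ρ x ≤ |c * ρ x| := le_abs_self _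
    _ = |c| * |ρ x| := abs_mul _ _
    _ ≤ |c| * B := by gcongr; exact hB x

lemma gibbsTilt_eq_tilted (π : Measure Λ) (ρ : Λ → ℝ) (θ : ℝ) :
    gibbsTilt π ρ θ = π.tilted (fun x => -θ * ρ x) := rfl

lemma isProbabilityMeasure_gibbsTilt [IsProbabilityMeasure π] (hρ : Measurable ρ)
    (hB : ∀ x, |ρ x| ≤ B) (θ : ℝ) : IsProbabilityMeasure (gibbsTilt π ρ θ) :=
  isProbabilityMeasure_tilted (integrable_exp_mul_of_abs_le hρ hB _)

lemma llr_gibbsTilt_self [IsProbabilityMeasure π] (hρ : Measurable ρ)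
    (hB : ∀ x, |ρ x| ≤ B) (θ : ℝ) :
    llr (gibbsTilt π ρ θ) π =ᵐ[gibbsTilt π ρ θ]
      fun x => -θ * ρ x - Real.log (partitionZ π ρ θ) :=
  (tilted_absolutelyContinuous π _).ae_le
    (log_rnDeriv_tilted_left_self (integrable_exp_mul_of_abs_le hρ hB (-θ)))

lemma integrable_llr_gibbsTilt_self [IsProbabilityMeasure π] (hρ : Measurable ρ)
    (hB : ∀ x, |ρ x| ≤ B) (θ : ℝ) :
    Integrable (llr (gibbsTilt π ρ θ) π) (gibbsTilt π ρ θ) := by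
  have := isProbabilityMeasure_gibbsTilt (π := π) hρ hB θ
  rw [integrable_congr (llr_gibbsTilt_self hρ hB θ)]
  exact ((integrable_of_abs_le hρ hB).const_mul _).sub (integrable_const _)

lemma integral_llr_gibbsTilt_self [IsProbabilityMeasure π] (hρ : Measurable ρ)
    (hB : ∀ x, |ρ x| ≤ B) (θ : ℝ) :
    ∫ x, llr (gibbsTilt π ρ θ) π x ∂(gibbsTilt π ρ θ)
      = -θ * tiltMean π ρ θ - Real.log (partitionZ π ρ θ) := by
  have := isProbabilityMeasure_gibbsTilt (π := π) hρ hB θ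
  rw [integral_congr_ae (llr_gibbsTilt_self hρ hB θ),
    integral_sub ((integrable_of_abs_le hρ hB).const_mul _) (integrable_const _),
    integral_const_mul]
  simp [tiltMean]

/-- The Donsker–Varadhan identity for the Gibbs tilt. -/
lemma integral_llr_gibbsTilt_right [IsProbabilityMeasure π] [IsProbabilityMeasure μ]
    (hρ : Measurable ρ) (hB : ∀ x, |ρ x| ≤ B) (θ : ℝ) (hμ : μ ≪ π)
    (h_int : Integrable (llr μ π) μ) :
    ∫ x, llr μ (gibbsTilt π ρ θ) x ∂μ
      = ∫ x, llr μ π x ∂μ + θ * ∫ x, ρ x ∂μ + Real.log (partitionZ π ρ θ) := by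
  rw [gibbsTilt_eq_tilted, integral_llr_tilted_right hμ
    ((integrable_of_abs_le hρ hB).const_mul _) (integrable_exp_mul_of_abs_le hρ hB _) h_int,
    integral_const_mul, partitionZ]
  ring

lemma integral_llr_nonneg {ν : Measure Λ} [IsProbabilityMeasure μ] [IsProbabilityMeasure ν]
    (h : μ ≪ ν) (h_int : Integrable (llr μ ν) μ) : 0 ≤ ∫ x, llr μ ν x ∂μ := by
  simpa using integral_llr_add_sub_measure_univ_nonneg h h_int

lemma aggObjective_eq_ofReal [IsProbabilityMeasure π] [IsProbabilityMeasure μ]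
    {γ α : ℝ} (hγ : 0 ≤ γ) (hα : 0 ≤ α) (a : ℝ) (hμ : μ ≪ π)
    (h_int : Integrable (llr μ π) μ) :
    aggObjective γ α a π ρ μ
      = ENNReal.ofReal (γ / 2 * (∫ x, ρ x ∂μ - a) ^ 2 + α * ∫ x, llr μ π x ∂μ) := by
  have hK := integral_llr_nonneg hμ h_int
  have h_kl : klDiv' μ π = ENNReal.ofReal (∫ x, llr μ π x ∂μ) := if_pos ⟨hμ, h_int⟩
  rw [aggObjective, h_kl, ← ENNReal.ofReal_mul hα,
    ← ENNReal.ofReal_add (by positivity) (by positivity)]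

/-- The excess of the objective over its value at the Gibbs tilt dominates the divergence
from the Gibbs tilt. -/
lemma aggObjective_gibbsTilt_add_le [IsProbabilityMeasure π] [IsProbabilityMeasure μ]
    (hρ : Measurable ρ) (hB : ∀ x, |ρ x| ≤ B) {γ α a θ : ℝ} (hγ : 0 < γ) (hα : 0 < α)
    (hfix : tiltMean π ρ θ = a + α / γ * θ) (hμ : μ ≪ π) :
    aggObjective γ α a π ρ (gibbsTilt π ρ θ)
        + ENNReal.ofReal α * klDiv μ (gibbsTilt π ρ θ)
      ≤ aggObjective γ α a π ρ μ := by
  have := isProbabilityMeasure_gibbsTilt (π := π) hρ hB θ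
  by_cases h_int : Integrable (llr μ π) μ
  · have h_exp := integrable_exp_mul_of_abs_le (μ := π) hρ hB (-θ)
    have hμ' : μ ≪ gibbsTilt π ρ θ := hμ.trans (absolutelyContinuous_tilted h_exp)
    have h_int' : Integrable (llr μ (gibbsTilt π ρ θ)) μ :=
      integrable_llr_tilted_right hμ ((integrable_of_abs_le hρ hB).const_mul _) h_int h_exp
    have h_ac : gibbsTilt π ρ θ ≪ π := tilted_absolutelyContinuous π _
    have h_int_tilt := integrable_llr_gibbsTilt_self (π := π) hρ hB θ
    have hD := integral_llr_nonneg hμ' h_int'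
    have hK := integral_llr_nonneg h_ac h_int_tilt
    have h_kl : klDiv μ (gibbsTilt π ρ θ)
        = ENNReal.ofReal (∫ x, llr μ (gibbsTilt π ρ θ) x ∂μ) := by
      simp [klDiv_of_ac_of_integrable hμ' h_int']
    rw [aggObjective_eq_ofReal hγ.le hα.le a hμ h_int,
      aggObjective_eq_ofReal hγ.le hα.le a h_ac h_int_tilt, h_kl, ← ENNReal.ofReal_mul hα.le,
      ← ENNReal.ofReal_add (by positivity) (by positivity)]
    apply ENNReal.ofReal_le_ofReal
    rw [integral_llr_gibbsTilt_self hρ hB, integral_llr_gibbsTilt_right hρ hB θ hμ h_int,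
      ← tiltMean]
    have h_lin : γ * (tiltMean π ρ θ - a) = α * θ := by rw [hfix]; field_simp; ring
    linear_combination γ / 2 * sq_nonneg (∫ x, ρ x ∂μ - tiltMean π ρ θ)
      + (tiltMean π ρ θ - ∫ x, ρ x ∂μ) * h_lin
  · have h_kl : klDiv' μ π = ∞ := if_neg fun h => h_int h.2
    have h_top : aggObjective γ α a π ρ μ = ∞ := by
      simp [aggObjective, h_kl, ENNReal.mul_top, hα]
    exact h_top ▸ le_top

end GibbsTilt

/-- the Gibbs tilt solves the pointwise Lagrangian problem. Let `γ, α > 0`,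
`a ∈ ℝ` and let `θ*` satisfy the fixed-point equation `ψ(θ*) = a + (α/γ)θ*`.  Then `μ_{θ*}`
is the unique minimizer of `F(μ) = (γ/2)(∫ρ dμ − a)² + α KL(μ‖π)` over probability measures
`μ ≪ π`. -/
theorem gibbsTilt_is_unique_minimizer
    {Λ : Type*} [MeasurableSpace Λ] [StandardBorelSpace Λ]
    (π : Measure Λ) [IsProbabilityMeasure π]
    (ρ : Λ → ℝ) (hρmeas : Measurable ρ) (B : ℝ) (hρbdd : ∀ x, |ρ x| ≤ B)
    (γ α a θstar : ℝ) (hγ : 0 < γ) (hα : 0 < α)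
    (hfix : tiltMean π ρ θstar = a + α / γ * θstar) :
    (∀ μ : Measure Λ, IsProbabilityMeasure μ → μ ≪ π →
        aggObjective γ α a π ρ (gibbsTilt π ρ θstar) ≤ aggObjective γ α a π ρ μ)
    ∧ (∀ μ : Measure Λ, IsProbabilityMeasure μ → μ ≪ π →
        aggObjective γ α a π ρ μ = aggObjective γ α a π ρ (gibbsTilt π ρ θstar) →
        μ = gibbsTilt π ρ θstar) := by
  refine ⟨fun μ _ hμ => le_self_add.trans
    (aggObjective_gibbsTilt_add_le hρmeas hρbdd hγ hα hfix hμ), fun μ _ hμ h_eq => ?_⟩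
  have := isProbabilityMeasure_gibbsTilt (π := π) hρmeas hρbdd θstar
  have h_le := aggObjective_gibbsTilt_add_le hρmeas hρbdd hγ hα hfix hμ
  have h_ne_top : aggObjective γ α a π ρ (gibbsTilt π ρ θstar) ≠ ∞ := by
    have h_ac : gibbsTilt π ρ θstar ≪ π := tilted_absolutelyContinuous π _
    rw [aggObjective_eq_ofReal hγ.le hα.le a h_ac
      (integrable_llr_gibbsTilt_self hρmeas hρbdd θstar)]
    exact ENNReal.ofReal_ne_top
  rw [h_eq] at h_le
  have h_zero : ENNReal.ofReal α * InformationTheory.klDiv μ (gibbsTilt π ρ θstar) = 0 := by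
    simpa using (ENNReal.add_le_add_iff_left h_ne_top).1 (h_le.trans_eq (add_zero _).symm)
  exact InformationTheory.klDiv_eq_zero_iff.1
    ((mul_eq_zero.1 h_zero).resolve_left (ENNReal.ofReal_pos.2 hα).ne')
end

section
/- Let m := essinf_π ρ and M := esssup_π ρ denote the π-essential infimum and supremum of ρ. Then m ≤ ψ(θ) ≤ M for all θ ∈ ℝ, lim_{θ → +∞} ψ(θ) = m, and lim_{θ → −∞} ψ(θ) = M. -/
open MeasureTheory Filter
open scoped ENNReal Topology

section TiltMean

variable {Λ : Type*} [MeasurableSpace Λ] {π : Measure Λ} {ρ : Λ → ℝ} {B : ℝ}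

theorem tiltMean_eq_integral_mul_div (θ : ℝ) :
    tiltMean π ρ θ = (∫ x, ρ x * Real.exp (-θ * ρ x) ∂π) / partitionZ π ρ θ := by
  change ∫ x, ρ x ∂(π.tilted fun x => -θ * ρ x) = _
  rw [integral_tilted, ← integral_div]
  refine integral_congr_ae (Eventually.of_forall fun x => ?_)
  simp only [smul_eq_mul, partitionZ]
  ring

theorem tiltMean_neg (θ : ℝ) : tiltMean π (-ρ) (-θ) = -tiltMean π ρ θ := by
  simp [tiltMean_eq_integral_mul_div, partitionZ, integral_neg, neg_div]

theorem integrable_exp_tilt [IsFiniteMeasure π] (hρ : Measurable ρ) (hB : ∀ x, |ρ x| ≤ B)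
    (θ : ℝ) : Integrable (fun x => Real.exp (-θ * ρ x)) π := by
  refine Integrable.of_bound (by fun_prop) (Real.exp (|θ| * B)) (Eventually.of_forall fun x => ?_)
  rw [Real.norm_eq_abs, Real.abs_exp]
  refine Real.exp_le_exp.2 ((le_abs_self _).trans ?_)
  rw [abs_mul, abs_neg]
  exact mul_le_mul_of_nonneg_left (hB x) (abs_nonneg θ)

theorem integrable_mul_exp_tilt [IsFiniteMeasure π] (hρ : Measurable ρ) (hB : ∀ x, |ρ x| ≤ B)
    (θ : ℝ) : Integrable (fun x => ρ x * Real.exp (-θ * ρ x)) π :=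
  (integrable_exp_tilt hρ hB θ).bdd_mul hρ.aestronglyMeasurable (Eventually.of_forall hB)

theorem partitionZ_pos [IsProbabilityMeasure π] (hρ : Measurable ρ) (hB : ∀ x, |ρ x| ≤ B)
    (θ : ℝ) : 0 < partitionZ π ρ θ :=
  integral_exp_pos (integrable_exp_tilt hρ hB θ)

theorem tiltMean_sub_const [IsProbabilityMeasure π] (hρ : Measurable ρ) (hB : ∀ x, |ρ x| ≤ B)
    (θ c : ℝ) :
    tiltMean π ρ θ - c = (∫ x, (ρ x - c) * Real.exp (-θ * ρ x) ∂π) / partitionZ π ρ θ := by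
  have hZ := (partitionZ_pos (π := π) hρ hB θ).ne'
  simp only [sub_mul]
  rw [integral_sub (integrable_mul_exp_tilt hρ hB θ) ((integrable_exp_tilt hρ hB θ).const_mul c),
    integral_const_mul, sub_div, ← tiltMean_eq_integral_mul_div]
  change _ = _ - c * partitionZ π ρ θ / _
  rw [mul_div_cancel_right₀ _ hZ]

theorem le_tiltMean [IsProbabilityMeasure π] (hρ : Measurable ρ) (hB : ∀ x, |ρ x| ≤ B)
    {m : ℝ} (hm : ∀ᵐ x ∂π, m ≤ ρ x) (θ : ℝ) : m ≤ tiltMean π ρ θ := by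
  rw [← sub_nonneg, tiltMean_sub_const hρ hB]
  refine div_nonneg (integral_nonneg_of_ae ?_) (partitionZ_pos hρ hB θ).le
  filter_upwards [hm] with x hx
  exact mul_nonneg (sub_nonneg.2 hx) (Real.exp_pos _).le

theorem measureReal_mul_exp_le_partitionZ [IsProbabilityMeasure π] (hρ : Measurable ρ)
    (hB : ∀ x, |ρ x| ≤ B) {θ : ℝ} (hθ : 0 ≤ θ) (c : ℝ) :
    π.real {x | ρ x < c} * Real.exp (-θ * c) ≤ partitionZ π ρ θ := by
  have hi := integrable_exp_tilt (π := π) hρ hB θ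
  refine le_trans ?_ (mul_meas_ge_le_integral_of_nonneg
    (Eventually.of_forall fun x => (Real.exp_pos _).le) hi (Real.exp (-θ * c)))
  rw [mul_comm]
  refine mul_le_mul_of_nonneg_left (measureReal_mono fun x hx => ?_) (Real.exp_pos _).le
  have hx' : ρ x < c := hx
  exact Real.exp_le_exp.2 (by nlinarith)

theorem tiltMean_le_add [IsProbabilityMeasure π] (hρ : Measurable ρ) (hB : ∀ x, |ρ x| ≤ B)
    {m a θ : ℝ} (ha : 0 < a) (hθ : 0 ≤ θ) (hp : π {x | ρ x < m + a} ≠ 0) :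
    tiltMean π ρ θ ≤
      m + 2 * a + (B + |m|) / π.real {x | ρ x < m + a} * Real.exp (-(θ * a)) := by
  obtain ⟨x₀⟩ := nonempty_of_isProbabilityMeasure π
  have hC : 0 ≤ B + |m| := add_nonneg ((abs_nonneg _).trans (hB x₀)) (abs_nonneg m)
  have hp' : 0 < π.real {x | ρ x < m + a} :=
    ENNReal.toReal_pos hp (measure_ne_top _ _)
  have hpt (x : Λ) : (ρ x - (m + 2 * a)) * Real.exp (-θ * ρ x) ≤
      (B + |m|) * Real.exp (-θ * (m + 2 * a)) := by
    rcases le_total (ρ x) (m + 2 * a) with h | h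
    · exact (mul_nonpos_of_nonpos_of_nonneg (sub_nonpos.2 h) (Real.exp_pos _).le).trans
        (by positivity)
    · refine mul_le_mul ?_ (Real.exp_le_exp.2 (by nlinarith)) (Real.exp_pos _).le hC
      linarith [le_abs_self (ρ x), hB x, neg_abs_le m]
  have hint : ∫ x, (ρ x - (m + 2 * a)) * Real.exp (-θ * ρ x) ∂π ≤
      (B + |m|) * Real.exp (-θ * (m + 2 * a)) := by
    refine (integral_mono ?_ (integrable_const _) hpt).trans (by simp)
    simp only [sub_mul]
    exact (integrable_mul_exp_tilt hρ hB θ).sub ((integrable_exp_tilt hρ hB θ).const_mul _)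
  rw [← sub_le_iff_le_add', tiltMean_sub_const hρ hB]
  calc _ ≤ (B + |m|) * Real.exp (-θ * (m + 2 * a)) /
        (π.real {x | ρ x < m + a} * Real.exp (-θ * (m + a))) :=
        div_le_div₀ (by positivity) hint (by positivity)
          (measureReal_mul_exp_le_partitionZ hρ hB hθ _)
    _ = _ := by
        rw [mul_div_mul_comm, ← Real.exp_sub]
        ring_nf

theorem tendsto_tiltMean_atTop [IsProbabilityMeasure π] (hρ : Measurable ρ)
    (hB : ∀ x, |ρ x| ≤ B) {m : ℝ} (hm : ∀ᵐ x ∂π, m ≤ ρ x)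
    (hp : ∀ a > 0, π {x | ρ x < m + a} ≠ 0) : Tendsto (tiltMean π ρ) atTop (𝓝 m) := by
  refine tendsto_order.2 ⟨fun b hb => Eventually.of_forall fun θ =>
    hb.trans_le (le_tiltMean hρ hB hm θ), fun b hb => ?_⟩
  set a := (b - m) / 4 with ha_def
  have ha : 0 < a := by linarith
  have hlim : Tendsto (fun θ : ℝ => m + 2 * a +
      (B + |m|) / π.real {x | ρ x < m + a} * Real.exp (-(θ * a))) atTop (𝓝 (m + 2 * a)) := by
    have h := Real.tendsto_exp_neg_atTop_nhds_zero.comp (tendsto_id.atTop_mul_const ha)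
    simpa using (h.const_mul ((B + |m|) / π.real {x | ρ x < m + a})).const_add (m + 2 * a)
  filter_upwards [hlim.eventually_lt_const (show m + 2 * a < b by linarith),
    eventually_ge_atTop 0] with θ hθ hθ0
  exact (tiltMean_le_add hρ hB ha hθ0 (hp a ha)).trans_lt hθ

end TiltMean

/-- range of the tilted mean. With `m := essinf_π ρ` and
`M := esssup_π ρ`, one has `m ≤ ψ(θ) ≤ M` for all `θ`, `ψ(θ) → m` as `θ → +∞`, and
`ψ(θ) → M` as `θ → −∞`. -/
theorem tiltMean_range_and_limits
    {Λ : Type*} [MeasurableSpace Λ] [StandardBorelSpace Λ]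
    (π : Measure Λ) [IsProbabilityMeasure π]
    (ρ : Λ → ℝ) (hρmeas : Measurable ρ) (B : ℝ) (hρbdd : ∀ x, |ρ x| ≤ B) :
    (∀ θ : ℝ, essInf ρ π ≤ tiltMean π ρ θ ∧ tiltMean π ρ θ ≤ essSup ρ π)
    ∧ Tendsto (tiltMean π ρ) atTop (𝓝 (essInf ρ π))
    ∧ Tendsto (tiltMean π ρ) atBot (𝓝 (essSup ρ π)) := by
  have hb : IsBoundedUnder (· ≤ ·) (ae π) ρ :=
    isBoundedUnder_of ⟨B, fun x => (abs_le.1 (hρbdd x)).2⟩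
  have hb' : IsBoundedUnder (· ≥ ·) (ae π) ρ :=
    isBoundedUnder_of ⟨-B, fun x => (abs_le.1 (hρbdd x)).1⟩
  have hm : ∀ᵐ x ∂π, essInf ρ π ≤ ρ x := ae_essInf_le hb'
  have hM : ∀ᵐ x ∂π, (-essSup ρ π) ≤ (-ρ) x := by
    filter_upwards [ae_le_essSup hb] with x hx using neg_le_neg hx
  have hneg : ∀ x, |(-ρ) x| ≤ B := fun x => by simpa using hρbdd x
  refine ⟨fun θ => ⟨le_tiltMean hρmeas hρbdd hm θ, ?_⟩,
    tendsto_tiltMean_atTop hρmeas hρbdd hm fun a ha h0 => ?_, ?_⟩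
  · have h := le_tiltMean hρmeas.neg hneg hM (-θ)
    rw [tiltMean_neg] at h
    exact neg_le_neg_iff.1 h
  · have h : ∀ᵐ x ∂π, essInf ρ π + a ≤ ρ x := by
      simpa [ae_iff] using h0
    linarith [le_essInf_of_ae_le (essInf ρ π + a) h hb.isCoboundedUnder_ge]
  · have h := (tendsto_tiltMean_atTop hρmeas.neg hneg hM fun a ha h0 => ?_).comp
      tendsto_neg_atBot_atTop
    · have h' := h.neg
      simpa [Function.comp_def, tiltMean_neg] using h'
    · have h : ∀ᵐ x ∂π, ρ x ≤ essSup ρ π - a := by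
        rw [ae_iff]
        convert h0 using 3
        ext x
        simp only [not_le, Pi.neg_apply]
        constructor <;> intro h <;> linarith
      linarith [essSup_le_of_ae_le (essSup ρ π - a) h hb'.isCoboundedUnder_le]
end

section
/- The function θ ↦ −θ·ψ(θ) − log Z(θ), which equals KL(μ_θ‖π) for every θ, is differentiable on ℝ with derivative θ·Var_{μ_θ}(ρ) at every θ ∈ ℝ. In particular it is nondecreasing on [0, ∞) and nonincreasing on (−∞, 0], and attains its minimum value 0 at θ = 0. -/
open MeasureTheory
open scoped ENNReal

/-- Tilted variance `Var_{μ_θ}(ρ) = ∫ (ρ − ψ(θ))² dμ_θ`. -/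
noncomputable def tiltVar {Λ : Type*} [MeasurableSpace Λ] (π : Measure Λ) (ρ : Λ → ℝ)
    (θ : ℝ) : ℝ :=
  ∫ x, (ρ x - tiltMean π ρ θ) ^ 2 ∂(gibbsTilt π ρ θ)

/-- The function `θ ↦ −θ·ψ(θ) − log Z(θ)`, which equals `KL(μ_θ‖π)`. -/
noncomputable def klOfTilt {Λ : Type*} [MeasurableSpace Λ] (π : Measure Λ) (ρ : Λ → ℝ)
    (θ : ℝ) : ℝ :=
  -θ * tiltMean π ρ θ - Real.log (partitionZ π ρ θ)

open ProbabilityTheory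

section ExponentialTilt

variable {Λ : Type*} [MeasurableSpace Λ] {π : Measure Λ} {ρ : Λ → ℝ} {θ : ℝ}

lemma log_partitionZ_eq_cgf (π : Measure Λ) (ρ : Λ → ℝ) (θ : ℝ) :
    Real.log (partitionZ π ρ θ) = cgf ρ π (-θ) := rfl

lemma tiltMean_eq_deriv_cgf (h : -θ ∈ interior (integrableExpSet ρ π)) :
    tiltMean π ρ θ = deriv (cgf ρ π) (-θ) :=
  integral_tilted_mul_self h

lemma tiltVar_eq_deriv_deriv_cgf (h : -θ ∈ interior (integrableExpSet ρ π)) :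
    tiltVar π ρ θ = deriv (deriv (cgf ρ π)) (-θ) := by
  have hρ : AEMeasurable ρ (π.tilted (-θ * ρ ·)) :=
    (memLp_tilted_mul h 1).aestronglyMeasurable.aemeasurable
  rw [← iteratedDeriv_one (f := cgf ρ π), ← iteratedDeriv_succ, ← variance_tilted_mul h,
    variance_eq_integral hρ]
  rfl

lemma tiltVar_nonneg (π : Measure Λ) (ρ : Λ → ℝ) (θ : ℝ) : 0 ≤ tiltVar π ρ θ :=
  integral_nonneg fun _ => sq_nonneg _

lemma klOfTilt_zero [IsProbabilityMeasure π] : klOfTilt π ρ 0 = 0 := by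
  simp [klOfTilt, partitionZ]

lemma klDiv'_gibbsTilt [IsProbabilityMeasure π] (h : -θ ∈ interior (integrableExpSet ρ π)) :
    klDiv' (gibbsTilt π ρ θ) π = ENNReal.ofReal (klOfTilt π ρ θ) := by
  have hexp : Integrable (fun x => Real.exp (-θ * ρ x)) π :=
    interior_subset (s := integrableExpSet ρ π) h
  have hac : gibbsTilt π ρ θ ≪ π := tilted_absolutelyContinuous _ _
  have : IsProbabilityMeasure (gibbsTilt π ρ θ) := isProbabilityMeasure_tilted hexp
  have hlog : (fun x => Real.log ((gibbsTilt π ρ θ).rnDeriv π x).toReal)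
      =ᵐ[gibbsTilt π ρ θ] fun x => -θ * ρ x - Real.log (partitionZ π ρ θ) :=
    hac.ae_eq (log_rnDeriv_tilted_left_self hexp)
  have hρ : Integrable ρ (gibbsTilt π ρ θ) :=
    memLp_one_iff_integrable.mp (mod_cast memLp_tilted_mul h 1)
  have hint : Integrable (fun x => -θ * ρ x - Real.log (partitionZ π ρ θ)) (gibbsTilt π ρ θ) :=
    (hρ.const_mul _).sub (integrable_const _)
  rw [klDiv', if_pos ⟨hac, hint.congr hlog.symm⟩, integral_congr_ae hlog,
    integral_sub (hρ.const_mul _) (integrable_const _), integral_const_mul]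
  simp [klOfTilt, tiltMean]

lemma hasDerivAt_klOfTilt (h : integrableExpSet ρ π = Set.univ) (θ : ℝ) :
    HasDerivAt (klOfTilt π ρ) (θ * tiltVar π ρ θ) θ := by
  have hmem (t : ℝ) : t ∈ interior (integrableExpSet ρ π) := by simp [h]
  have hcgf := analyticAt_cgf (hmem (-θ))
  have hneg := hasDerivAt_neg θ
  have h₀ : HasDerivAt (fun t => cgf ρ π (-t)) _ θ :=
    hcgf.differentiableAt.hasDerivAt.comp θ hneg
  have h₁ : HasDerivAt (fun t => deriv (cgf ρ π) (-t)) _ θ :=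
    hcgf.deriv.differentiableAt.hasDerivAt.comp θ hneg
  have hfun : klOfTilt π ρ = fun t => -t * deriv (cgf ρ π) (-t) - cgf ρ π (-t) := by
    ext t
    rw [klOfTilt, tiltMean_eq_deriv_cgf (hmem _), log_partitionZ_eq_cgf]
  rw [hfun, tiltVar_eq_deriv_deriv_cgf (hmem _)]
  convert! (hneg.mul h₁).sub h₀ using 1
  ring

lemma monotoneOn_klOfTilt (h : integrableExpSet ρ π = Set.univ) :
    MonotoneOn (klOfTilt π ρ) (Set.Ici 0) := by
  have hd := hasDerivAt_klOfTilt h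
  refine monotoneOn_of_deriv_nonneg (convex_Ici 0)
    (fun t _ => (hd t).continuousAt.continuousWithinAt)
    (fun t _ => (hd t).differentiableAt.differentiableWithinAt) fun t ht => ?_
  rw [(hd t).deriv]
  exact mul_nonneg (interior_subset (s := Set.Ici 0) ht) (tiltVar_nonneg π ρ t)

lemma antitoneOn_klOfTilt (h : integrableExpSet ρ π = Set.univ) :
    AntitoneOn (klOfTilt π ρ) (Set.Iic 0) := by
  have hd := hasDerivAt_klOfTilt h
  refine antitoneOn_of_deriv_nonpos (convex_Iic 0)
    (fun t _ => (hd t).continuousAt.continuousWithinAt)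
    (fun t _ => (hd t).differentiableAt.differentiableWithinAt) fun t ht => ?_
  rw [(hd t).deriv]
  exact mul_nonpos_of_nonpos_of_nonneg (interior_subset (s := Set.Iic 0) ht) (tiltVar_nonneg π ρ t)

end ExponentialTilt

/-- monotonicity of the KL divergence of the tilt. The function
`θ ↦ −θψ(θ) − log Z(θ)`, which equals `KL(μ_θ‖π)` for every `θ`, is differentiable with
derivative `θ·Var_{μ_θ}(ρ)`; it is nondecreasing on `[0,∞)`, nonincreasing on `(−∞,0]`, and
attains its minimum value `0` at `θ = 0`. -/
theorem klOfTilt_derivative_and_monotonicity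
    {Λ : Type*} [MeasurableSpace Λ] [StandardBorelSpace Λ]
    (π : Measure Λ) [IsProbabilityMeasure π]
    (ρ : Λ → ℝ) (hρmeas : Measurable ρ) (B : ℝ) (hρbdd : ∀ x, |ρ x| ≤ B) :
    (∀ θ : ℝ, klDiv' (gibbsTilt π ρ θ) π = ENNReal.ofReal (klOfTilt π ρ θ))
    ∧ (∀ θ : ℝ, HasDerivAt (klOfTilt π ρ) (θ * tiltVar π ρ θ) θ)
    ∧ MonotoneOn (klOfTilt π ρ) (Set.Ici (0 : ℝ))
    ∧ AntitoneOn (klOfTilt π ρ) (Set.Iic (0 : ℝ))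
    ∧ klOfTilt π ρ 0 = 0
    ∧ (∀ θ : ℝ, klOfTilt π ρ 0 ≤ klOfTilt π ρ θ) := by
  have h : integrableExpSet ρ π = Set.univ := Set.eq_univ_of_forall fun t =>
    integrable_exp_mul_of_mem_Icc hρmeas.aemeasurable (.of_forall fun x => abs_le.mp (hρbdd x))
  have hmono := monotoneOn_klOfTilt h
  have hanti := antitoneOn_klOfTilt h
  refine ⟨fun θ => klDiv'_gibbsTilt (by simp [h]), hasDerivAt_klOfTilt h, hmono, hanti,
    klOfTilt_zero, fun θ => ?_⟩
  rcases le_total 0 θ with hθ | hθ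
  · exact hmono Set.self_mem_Ici hθ hθ
  · exact hanti hθ Set.self_mem_Iic hθ
end
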